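/- arXiv:1103.3891 — 2 statements merged into one kernel-verified Lean document; each statement's English description precedes it below -/
import Mathlib

section
/- For d ≥ 1 let H_d = span_ℂ{X_{jk}, Y_{jk} : j + k = d}, the space of planar polynomial vector fields whose components are homogeneous of degree d. Then ad_e maps H_d into itself; if d = 2k + 1 is odd, then H_d is the internal direct sum ad_e(H_d) ⊕ span_ℂ{X_{(k+1)k}, Y_{(k+1)k}}; and if d is even, then ad_e(H_d) = H_d. -/
open MvPolynomial

/-- Planar polynomial vector fields: pairs of polynomials in `z = X 0`, `w = X 1`. -/
abbrev PlanarVF := MvPolynomial (Fin 2) ℂ × MvPolynomial (Fin 2) ℂ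

/-- `Du·v`, where `(Du·v)_a = (∂u_a/∂z)·v₁ + (∂u_a/∂w)·v₂`. -/
noncomputable def planarD (u v : PlanarVF) : PlanarVF :=
  (pderiv 0 u.1 * v.1 + pderiv 1 u.1 * v.2,
   pderiv 0 u.2 * v.1 + pderiv 1 u.2 * v.2)

/-- The bracket `[u, v] = Du·v − Dv·u`. -/
noncomputable def planarBracket (u v : PlanarVF) : PlanarVF :=
  planarD u v - planarD v u

/-- `X_{jk} = (z^j w^k, w^j z^k)`. -/
noncomputable def planarX (j k : ℕ) : PlanarVF :=
  (X 0 ^ j * X 1 ^ k, X 1 ^ j * X 0 ^ k)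

/-- `Y_{jk} = (i z^j w^k, −i w^j z^k)`. -/
noncomputable def planarY (j k : ℕ) : PlanarVF :=
  (C Complex.I * (X 0 ^ j * X 1 ^ k), -(C Complex.I) * (X 1 ^ j * X 0 ^ k))

/-- `e = Y_{10} = (iz, −iw)`. -/
noncomputable def planarE : PlanarVF := planarY 1 0

/-- `ad_e = [e, ·]` as a `ℂ`-linear map on planar polynomial vector fields. -/
noncomputable def planarAdE : PlanarVF →ₗ[ℂ] PlanarVF where
  toFun u := planarBracket planarE u
  map_add' u v := by
    refine Prod.ext ?_ ?_ <;>
      simp [planarBracket, planarD, map_add] <;> ring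
  map_smul' c u := by
    refine Prod.ext ?_ ?_ <;>
      simp [planarBracket, planarD, smul_eq_C_mul] <;> ring

/-- `H_d`: the span of the `X_{jk}`, `Y_{jk}` with `j + k = d` (vector fields with
homogeneous components of degree `d`). -/
noncomputable def planarH (d : ℕ) : Submodule ℂ PlanarVF :=
  Submodule.span ℂ {p : PlanarVF | ∃ j k : ℕ, j + k = d ∧ (p = planarX j k ∨ p = planarY j k)}

lemma planar_comm (j k : ℕ) :
    (X 1 ^ j * X 0 ^ k : MvPolynomial (Fin 2) ℂ) = X 0 ^ k * X 1 ^ j := mul_comm _ _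

lemma planar_pd0 (j k : ℕ) : X 0 * pderiv 0 (X 0 ^ j * X 1 ^ k : MvPolynomial (Fin 2) ℂ)
    = C (j : ℂ) * (X 0 ^ j * X 1 ^ k) := by
  rcases j with _ | j
  · simp [pderiv_X]
  · simp [pderiv_X]; ring

lemma planar_pd1 (j k : ℕ) : X 1 * pderiv 1 (X 0 ^ j * X 1 ^ k : MvPolynomial (Fin 2) ℂ)
    = C (k : ℂ) * (X 0 ^ j * X 1 ^ k) := by
  rcases k with _ | k
  · simp [pderiv_X]
  · simp [pderiv_X]; ring

lemma planarAdE_fst (u : PlanarVF) : (planarAdE u).1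
    = C Complex.I * (u.1 - X 0 * pderiv 0 u.1 + X 1 * pderiv 1 u.1) := by
  simp [planarAdE, planarBracket, planarD, planarE, planarY, pderiv_X]
  ring

lemma planarAdE_snd (u : PlanarVF) : (planarAdE u).2
    = C Complex.I * (- u.2 - X 0 * pderiv 0 u.2 + X 1 * pderiv 1 u.2) := by
  simp [planarAdE, planarBracket, planarD, planarE, planarY, pderiv_X]
  ring

lemma planar_CI : (C Complex.I : MvPolynomial (Fin 2) ℂ) * C Complex.I = -1 := by
  rw [← C_mul, Complex.I_mul_I]; simp

lemma planarAdE_X (j k : ℕ) : planarAdE (planarX j k) = (1 - j + k : ℂ) • planarY j k := by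
  have h0 := planar_pd0 j k
  have h1 := planar_pd1 j k
  have h2 := planar_pd0 k j
  have h3 := planar_pd1 k j
  refine Prod.ext ?_ ?_
  · rw [planarAdE_fst]
    simp only [planarX, planarY, Prod.smul_fst, smul_eq_C_mul, h0, h1, C_add, C_sub, C_1]
    ring
  · rw [planarAdE_snd]
    simp only [planarX, planarY, Prod.smul_snd, smul_eq_C_mul, planar_comm j k,
      h2, h3, C_add, C_sub, C_1]
    ring

lemma planarAdE_Y (j k : ℕ) : planarAdE (planarY j k) = (-(1 - j + k) : ℂ) • planarX j k := by
  have h0 := planar_pd0 j k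
  have h1 := planar_pd1 j k
  have h2 := planar_pd0 k j
  have h3 := planar_pd1 k j
  refine Prod.ext ?_ ?_
  · rw [planarAdE_fst]
    simp only [planarX, planarY, Prod.smul_fst, smul_eq_C_mul, pderiv_C_mul, C_neg, C_add, C_sub,
      C_1, mul_left_comm (X _) (C _) _, h0, h1]
    linear_combination (1 - C (j : ℂ) + C (k : ℂ)) * (X 0 ^ j * X 1 ^ k) * planar_CI
  · rw [planarAdE_snd]
    simp only [planarX, planarY, Prod.smul_snd, smul_eq_C_mul, planar_comm j k,
      neg_mul, map_neg, mul_neg, pderiv_C_mul, C_neg, C_add, C_sub,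
      C_1, mul_left_comm (X _) (C _) _, h2, h3]
    linear_combination (1 - C (j : ℂ) + C (k : ℂ)) * (X 0 ^ k * X 1 ^ j) * planar_CI

lemma planar_coeff (a b j k : ℕ) :
    coeff (Finsupp.single 0 a + Finsupp.single 1 b) (X 0 ^ j * X 1 ^ k : MvPolynomial (Fin 2) ℂ)
      = if j = a ∧ k = b then 1 else 0 := by
  rw [X_pow_eq_monomial, X_pow_eq_monomial, monomial_mul, coeff_monomial, mul_one]
  congr 1
  apply propext
  constructor
  · intro h
    have h0 := DFunLike.congr_fun h 0
    have h1 := DFunLike.congr_fun h 1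
    simp at h0 h1
    exact ⟨h0, h1⟩
  · rintro ⟨rfl, rfl⟩; rfl

lemma planarX_mem {d j k : ℕ} (h : j + k = d) : planarX j k ∈ planarH d :=
  Submodule.subset_span ⟨j, k, h, Or.inl rfl⟩

lemma planarY_mem {d j k : ℕ} (h : j + k = d) : planarY j k ∈ planarH d :=
  Submodule.subset_span ⟨j, k, h, Or.inr rfl⟩

lemma planar_map_le (d : ℕ) : Submodule.map planarAdE (planarH d) ≤ planarH d := by
  rw [Submodule.map_le_iff_le_comap]
  refine Submodule.span_le.2 ?_
  rintro p ⟨j, k, h, rfl | rfl⟩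
  · simpa only [SetLike.mem_coe, Submodule.mem_comap, planarAdE_X] using
      Submodule.smul_mem _ _ (planarY_mem h)
  · simpa only [SetLike.mem_coe, Submodule.mem_comap, planarAdE_Y] using
      Submodule.smul_mem _ _ (planarX_mem h)

lemma planar_c_ne {j k : ℕ} (h : j ≠ k + 1) : (1 - j + k : ℂ) ≠ 0 := by
  intro h0
  apply h
  have : (j : ℂ) = ((k + 1 : ℕ) : ℂ) := by push_cast; linear_combination -h0
  exact_mod_cast this

lemma planarX_mem_map {d j k : ℕ} (h : j + k = d) (hn : j ≠ k + 1) :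
    planarX j k ∈ Submodule.map planarAdE (planarH d) := by
  have hc := neg_ne_zero.2 (planar_c_ne hn)
  refine ⟨(-(1 - j + k : ℂ))⁻¹ • planarY j k, Submodule.smul_mem _ _ (planarY_mem h), ?_⟩
  rw [map_smul, planarAdE_Y, smul_smul, inv_mul_cancel₀ hc, one_smul]

lemma planarY_mem_map {d j k : ℕ} (h : j + k = d) (hn : j ≠ k + 1) :
    planarY j k ∈ Submodule.map planarAdE (planarH d) := by
  have hc := planar_c_ne hn
  refine ⟨((1 - j + k : ℂ))⁻¹ • planarX j k, Submodule.smul_mem _ _ (planarX_mem h), ?_⟩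
  rw [map_smul, planarAdE_X, smul_smul, inv_mul_cancel₀ hc, one_smul]

/-- The pair of resonant coefficients. -/
noncomputable def planarPhi (k : ℕ) : PlanarVF →ₗ[ℂ] ℂ × ℂ :=
  LinearMap.prodMap
    (lcoeff ℂ (Finsupp.single 0 (k + 1) + Finsupp.single 1 k))
    (lcoeff ℂ (Finsupp.single 0 k + Finsupp.single 1 (k + 1)))

lemma planarPhi_X (k j l : ℕ) : planarPhi k (planarX j l) =
    if j = k + 1 ∧ l = k then (1, 1) else 0 := by
  simp only [planarPhi, planarX, LinearMap.prodMap_apply, lcoeff_apply,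
    planar_comm j l, planar_coeff, and_comm (a := l = k)]
  split_ifs <;> rfl

lemma planarPhi_Y (k j l : ℕ) : planarPhi k (planarY j l) =
    if j = k + 1 ∧ l = k then (Complex.I, -Complex.I) else 0 := by
  simp only [planarPhi, planarY, LinearMap.prodMap_apply, lcoeff_apply, neg_mul, coeff_neg,
    coeff_C_mul,
    planar_comm j l, planar_coeff, and_comm (a := l = k)]
  split_ifs <;> simp

lemma planarPhi_map (d k : ℕ) :
    Submodule.map planarAdE (planarH d) ≤ LinearMap.ker (planarPhi k) := by
  rw [Submodule.map_le_iff_le_comap]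
  refine Submodule.span_le.2 ?_
  rintro p ⟨j, l, h, rfl | rfl⟩
  · simp only [SetLike.mem_coe, Submodule.mem_comap, planarAdE_X, LinearMap.mem_ker, map_smul,
      planarPhi_Y]
    split_ifs with h
    · obtain ⟨rfl, rfl⟩ := h; simp
    · simp
  · simp only [SetLike.mem_coe, Submodule.mem_comap, planarAdE_Y, LinearMap.mem_ker, map_smul,
      planarPhi_X]
    split_ifs with h
    · obtain ⟨rfl, rfl⟩ := h; simp
    · simp

/-- `ad_e` maps `H_d` into itself; for odd `d = 2k+1`,
`H_d = ad_e(H_d) ⊕ span{X_{(k+1)k}, Y_{(k+1)k}}`; for even `d`, `ad_e(H_d) = H_d`. -/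
theorem planar_adE_homogeneous_decomposition (d : ℕ) (hd : 1 ≤ d) :
    (∀ u ∈ planarH d, planarAdE u ∈ planarH d) ∧
    (∀ k : ℕ, d = 2 * k + 1 →
      Submodule.map planarAdE (planarH d) ⊓
          Submodule.span ℂ {planarX (k + 1) k, planarY (k + 1) k} = ⊥ ∧
      Submodule.map planarAdE (planarH d) ⊔
          Submodule.span ℂ {planarX (k + 1) k, planarY (k + 1) k} = planarH d) ∧
    (Even d → Submodule.map planarAdE (planarH d) = planarH d) := by
  refine ⟨fun u hu => planar_map_le d ⟨u, hu, rfl⟩, ?_, ?_⟩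
  · intro k hk
    constructor
    · rw [eq_bot_iff]
      rintro v ⟨hv, hs⟩
      have hv := planarPhi_map d k hv
      obtain ⟨a, b, rfl⟩ := Submodule.mem_span_pair.1 hs
      rw [LinearMap.mem_ker, map_add, map_smul, map_smul, planarPhi_X, planarPhi_Y,
        if_pos ⟨rfl, rfl⟩, if_pos ⟨rfl, rfl⟩] at hv
      have h1 := congrArg Prod.fst hv
      have h2 := congrArg Prod.snd hv
      simp at h1 h2
      have ha : a = 0 := by linear_combination (h1 + h2) / 2
      have hb : b = 0 := by
        subst ha
        simpa using h1
      simp [ha, hb]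
    · apply le_antisymm
      · refine sup_le (planar_map_le d) (Submodule.span_le.2 ?_)
        rintro p (rfl | rfl)
        · exact planarX_mem (by omega)
        · exact planarY_mem (by omega)
      · refine Submodule.span_le.2 ?_
        rintro p ⟨j, l, h, hp⟩
        by_cases hn : j = l + 1
        · obtain rfl : l = k := by omega
          subst hn
          refine Submodule.mem_sup_right (Submodule.subset_span ?_)
          rcases hp with rfl | rfl <;> simp
        · apply Submodule.mem_sup_left
          rcases hp with rfl | rfl
          · exact planarX_mem_map h hn
          · exact planarY_mem_map h hn
  · intro he
    refine le_antisymm (planar_map_le d) (Submodule.span_le.2 ?_)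
    rintro p ⟨j, l, h, hp⟩
    have hn : j ≠ l + 1 := by
      obtain ⟨m, hm⟩ := he
      omega
    rcases hp with rfl | rfl
    · exact planarX_mem_map h hn
    · exact planarY_mem_map h hn
end

section
/- For all j, k ∈ ℕ and multi-indices a, b ∈ ℕ^m: [X_{(j+1)j}μ^a, X_{(k+1)k}μ^b] = 2(j − k)·X_{(j+k+1)(j+k)}μ^{a+b}, [X_{(j+1)j}μ^a, Y_{(k+1)k}μ^b] = −2k·Y_{(j+k+1)(j+k)}μ^{a+b}, and [Y_{(j+1)j}μ^a, Y_{(k+1)k}μ^b] = 0. In particular, the ℂ-span of {X_{(j+1)j}μ^a, Y_{(j+1)j}μ^a : j ∈ ℕ, a ∈ ℕ^m} is closed under the bracket (the space L_H is a Lie subalgebra). -/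
open MvPolynomial

/-- Parametric planar polynomial vector fields: pairs of polynomials in
`z = X (inl 0)`, `w = X (inl 1)` and the parameters `μ_i = X (inr i)`. -/
abbrev ParamVF (m : ℕ) := MvPolynomial (Fin 2 ⊕ Fin m) ℂ × MvPolynomial (Fin 2 ⊕ Fin m) ℂ

/-- `μ^a = μ₁^{a₁} ⋯ μ_m^{a_m}`. -/
noncomputable def muPow {m : ℕ} (a : Fin m → ℕ) : MvPolynomial (Fin 2 ⊕ Fin m) ℂ :=
  ∏ i, X (Sum.inr i) ^ a i

/-- `Du·v` with formal partial derivatives taken only with respect to `z` and `w`. -/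
noncomputable def paramD {m : ℕ} (u v : ParamVF m) : ParamVF m :=
  (pderiv (Sum.inl 0) u.1 * v.1 + pderiv (Sum.inl 1) u.1 * v.2,
   pderiv (Sum.inl 0) u.2 * v.1 + pderiv (Sum.inl 1) u.2 * v.2)

/-- The bracket `[u, v] = Du·v − Dv·u`. -/
noncomputable def paramBracket {m : ℕ} (u v : ParamVF m) : ParamVF m :=
  paramD u v - paramD v u

/-- `X_{jk} μ^a = (z^j w^k μ^a, w^j z^k μ^a)`. -/
noncomputable def paramX {m : ℕ} (j k : ℕ) (a : Fin m → ℕ) : ParamVF m :=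
  (X (Sum.inl 0) ^ j * X (Sum.inl 1) ^ k * muPow a,
   X (Sum.inl 1) ^ j * X (Sum.inl 0) ^ k * muPow a)

/-- `Y_{jk} μ^a = (i z^j w^k μ^a, −i w^j z^k μ^a)`. -/
noncomputable def paramY {m : ℕ} (j k : ℕ) (a : Fin m → ℕ) : ParamVF m :=
  (C Complex.I * (X (Sum.inl 0) ^ j * X (Sum.inl 1) ^ k * muPow a),
   -(C Complex.I) * (X (Sum.inl 1) ^ j * X (Sum.inl 0) ^ k * muPow a))

lemma pderiv_muPow_aux {m : ℕ} (a : Fin m → ℕ) (t : Fin 2) :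
    pderiv (Sum.inl t) (muPow a) = 0 := by
  unfold muPow
  refine Finset.prod_induction _ (fun p => pderiv (Sum.inl t) p = 0) ?_ (by simp) ?_
  · intro p q hp hq
    rw [pderiv_mul, hp, hq]; simp
  intro i _
  rw [Derivation.leibniz_pow, pderiv_X_of_ne (by simp)]
  simp

lemma muPow_add_aux {m : ℕ} (a b : Fin m → ℕ) : muPow (a + b) = muPow a * muPow b := by
  simp [muPow, pow_add, Finset.prod_mul_distrib]

lemma pd_aux {m : ℕ} (s t : Fin 2) (h : s ≠ t) (p q : ℕ) (a : Fin m → ℕ) :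
    pderiv (Sum.inl s) (X (Sum.inl s) ^ p * X (Sum.inl t) ^ q * muPow a) =
      (p : MvPolynomial (Fin 2 ⊕ Fin m) ℂ) * X (Sum.inl s) ^ (p - 1) * X (Sum.inl t) ^ q * muPow a := by
  rw [pderiv_mul, pderiv_muPow_aux, pderiv_mul, pderiv_pow, pderiv_pow, pderiv_X_self,
    pderiv_X_of_ne (by simpa using h.symm)]
  ring

lemma pd_aux2 {m : ℕ} (s t : Fin 2) (h : s ≠ t) (p q : ℕ) (a : Fin m → ℕ) :
    pderiv (Sum.inl s) (X (Sum.inl t) ^ p * X (Sum.inl s) ^ q * muPow a) =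
      (q : MvPolynomial (Fin 2 ⊕ Fin m) ℂ) * X (Sum.inl s) ^ (q - 1) * X (Sum.inl t) ^ p * muPow a := by
  rw [mul_comm (X (Sum.inl t) ^ p), pd_aux s t h]

lemma CI_aux {m : ℕ} : (C Complex.I * C Complex.I : MvPolynomial (Fin 2 ⊕ Fin m) ℂ) = -1 := by
  rw [← C_mul, Complex.I_mul_I]; simp

lemma rel_aux {m : ℕ} (j k : ℕ) (a b : Fin m → ℕ) :
      paramBracket (paramX (j + 1) j a) (paramX (k + 1) k b) =
        (2 * ((j : ℤ) - (k : ℤ))) • paramX (j + k + 1) (j + k) (a + b) ∧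
      paramBracket (paramX (j + 1) j a) (paramY (k + 1) k b) =
        (-(2 * (k : ℤ))) • paramY (j + k + 1) (j + k) (a + b) ∧
      paramBracket (paramY (j + 1) j a) (paramY (k + 1) k b) = 0 := by
  have h01 : (0 : Fin 2) ≠ 1 := by decide
  refine ⟨?_, ?_, ?_⟩ <;> refine Prod.ext ?_ ?_ <;>
  simp only [paramBracket, paramD, paramX, paramY, Prod.fst_sub, Prod.snd_sub, Prod.smul_fst,
    Prod.smul_snd, Prod.fst_zero, Prod.snd_zero, neg_mul, map_neg, pderiv_C_mul,
    pd_aux 0 1 h01, pd_aux 1 0 h01.symm, pd_aux2 0 1 h01, pd_aux2 1 0 h01.symm, muPow_add_aux] <;>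
  (try simp only [zsmul_eq_mul]) <;>
  rcases j with _ | j <;> rcases k with _ | k <;> push_cast <;>
  (try simp only [Nat.add_sub_cancel]) <;> ring_nf

lemma bracket_swap_aux {m : ℕ} (u v : ParamVF m) : paramBracket u v = - paramBracket v u := by
  simp [paramBracket]

lemma bracket_add_aux {m : ℕ} (u u' v : ParamVF m) :
    paramBracket (u + u') v = paramBracket u v + paramBracket u' v := by
  refine Prod.ext ?_ ?_ <;> simp [paramBracket, paramD] <;> ring

lemma bracket_smul_aux {m : ℕ} (c : ℂ) (u v : ParamVF m) :
    paramBracket (c • u) v = c • paramBracket u v := by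
  refine Prod.ext ?_ ?_ <;> simp [paramBracket, paramD, smul_eq_C_mul] <;> ring

lemma bracket_zero_aux {m : ℕ} (v : ParamVF m) : paramBracket 0 v = 0 := by
  simpa using bracket_smul_aux 0 0 v

lemma span_aux {m : ℕ} (S : Set (ParamVF m))
    (h : ∀ u ∈ S, ∀ v ∈ S, paramBracket u v ∈ Submodule.span ℂ S) :
    ∀ u ∈ Submodule.span ℂ S, ∀ v ∈ Submodule.span ℂ S, paramBracket u v ∈ Submodule.span ℂ S := by
  have key : ∀ (P : Set (ParamVF m)) (v : ParamVF m),
      (∀ u ∈ P, paramBracket u v ∈ Submodule.span ℂ S) →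
      ∀ u ∈ Submodule.span ℂ P, paramBracket u v ∈ Submodule.span ℂ S := by
    intro P v hP u hu
    induction hu using Submodule.span_induction with
    | mem x hx => exact hP x hx
    | zero => rw [bracket_zero_aux]; exact Submodule.zero_mem _
    | add x y _ _ hx hy => rw [bracket_add_aux]; exact Submodule.add_mem _ hx hy
    | smul c x _ hx => rw [bracket_smul_aux]; exact Submodule.smul_mem _ c hx
  intro u hu v hv
  refine key S v (fun x hx => ?_) u hu
  rw [bracket_swap_aux]
  refine Submodule.neg_mem _ (key S x (fun y hy => h y hy x hx) v hv)

/-- Bracket relations among the `X_{(j+1)j} μ^a`, `Y_{(j+1)j} μ^a`; consequently their span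
`L_H` is a Lie subalgebra. -/
theorem paramBracket_LH_relations (m : ℕ) :
    (∀ (j k : ℕ) (a b : Fin m → ℕ),
      paramBracket (paramX (j + 1) j a) (paramX (k + 1) k b) =
        (2 * ((j : ℤ) - (k : ℤ))) • paramX (j + k + 1) (j + k) (a + b) ∧
      paramBracket (paramX (j + 1) j a) (paramY (k + 1) k b) =
        (-(2 * (k : ℤ))) • paramY (j + k + 1) (j + k) (a + b) ∧
      paramBracket (paramY (j + 1) j a) (paramY (k + 1) k b) = 0) ∧
    (∀ u ∈ Submodule.span ℂ
        {p : ParamVF m | ∃ (j : ℕ) (a : Fin m → ℕ), p = paramX (j + 1) j a ∨ p = paramY (j + 1) j a},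
      ∀ v ∈ Submodule.span ℂ
        {p : ParamVF m | ∃ (j : ℕ) (a : Fin m → ℕ), p = paramX (j + 1) j a ∨ p = paramY (j + 1) j a},
      paramBracket u v ∈ Submodule.span ℂ
        {p : ParamVF m | ∃ (j : ℕ) (a : Fin m → ℕ), p = paramX (j + 1) j a ∨ p = paramY (j + 1) j a}) := by
  refine ⟨fun j k a b => rel_aux j k a b, span_aux _ ?_⟩
  have zs : ∀ (n : ℤ) (p : ParamVF m) (S : Set (ParamVF m)), p ∈ S → n • p ∈ Submodule.span ℂ S :=
    fun n p S hp => zsmul_mem (Submodule.subset_span hp) n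
  rintro u ⟨j, a, rfl | rfl⟩ v ⟨k, b, rfl | rfl⟩
  · rw [(rel_aux j k a b).1]
    exact zs _ _ _ ⟨j + k, a + b, Or.inl rfl⟩
  · rw [(rel_aux j k a b).2.1]
    exact zs _ _ _ ⟨j + k, a + b, Or.inr rfl⟩
  · rw [bracket_swap_aux, (rel_aux k j b a).2.1]
    exact Submodule.neg_mem _ (zs _ _ _ ⟨k + j, b + a, Or.inr rfl⟩)
  · rw [(rel_aux j k a b).2.2]
    exact Submodule.zero_mem _
end
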